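/- If u is biharmonic on ℝⁿ with polynomial growth |u(x)| ≤ B(1 + |x|^s) for some 0 ≤ s < 1, then Δu ≡ 0, i.e., u is harmonic. -/

import Mathlib

open MeasureTheory

noncomputable def lap {n : ℕ} (u : EuclideanSpace ℝ (Fin n) → ℝ)
    (x : EuclideanSpace ℝ (Fin n)) : ℝ :=
  ∑ i : Fin n, fderiv ℝ (fun y => fderiv ℝ u y (EuclideanSpace.single i 1)) x
    (EuclideanSpace.single i 1)

/-- Integration by parts in a fixed direction against a compactly supported function. -/
theorem integral_fderiv_mul_eq_neg_of_hasCompactSupport {n : ℕ}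
    {f g : EuclideanSpace ℝ (Fin n) → ℝ} (hf : ContDiff ℝ 1 f) (hg : ContDiff ℝ 1 g)
    (hgc : HasCompactSupport g) (v : EuclideanSpace ℝ (Fin n)) :
    ∫ y, fderiv ℝ f y v * g y = -∫ y, f y * fderiv ℝ g y v := by
  have hf' : Continuous fun y => fderiv ℝ f y v :=
    (hf.continuous_fderiv one_ne_zero).clm_apply continuous_const
  have hg' : Continuous fun y => fderiv ℝ g y v :=
    (hg.continuous_fderiv one_ne_zero).clm_apply continuous_const
  have hg'c : HasCompactSupport fun y => fderiv ℝ g y v :=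
    hgc.fderiv_apply ℝ v
  rw [integral_mul_fderiv_eq_neg_fderiv_mul_of_integrable, neg_neg]
  · exact (hf'.mul hg.continuous).integrable_of_hasCompactSupport hgc.mul_left
  · exact (hf.continuous.mul hg').integrable_of_hasCompactSupport hg'c.mul_left
  · exact (hf.continuous.mul hg.continuous).integrable_of_hasCompactSupport hgc.mul_left
  · exact fun y _ => hf.differentiable one_ne_zero y
  · exact fun y _ => hg.differentiable one_ne_zero y

theorem ContDiff.fderiv_apply_const {n : ℕ} {f : EuclideanSpace ℝ (Fin n) → ℝ}
    (hf : ContDiff ℝ (⊤ : ℕ∞) f) (v : EuclideanSpace ℝ (Fin n)) :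
    ContDiff ℝ (⊤ : ℕ∞) fun y => fderiv ℝ f y v :=
  (hf.fderiv_right (m := (⊤ : ℕ∞)) (by simp)).clm_apply contDiff_const

theorem ContDiff.lap {n : ℕ} {f : EuclideanSpace ℝ (Fin n) → ℝ}
    (hf : ContDiff ℝ (⊤ : ℕ∞) f) : ContDiff ℝ (⊤ : ℕ∞) (lap f) :=
  ContDiff.sum fun i _ => (hf.fderiv_apply_const (EuclideanSpace.single i 1)).fderiv_apply_const
    (EuclideanSpace.single i 1)

theorem integral_lap_mul_eq_of_hasCompactSupport {n : ℕ}
    {f g : EuclideanSpace ℝ (Fin n) → ℝ} (hf : ContDiff ℝ (⊤ : ℕ∞) f)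
    (hg : ContDiff ℝ (⊤ : ℕ∞) g) (hgc : HasCompactSupport g) :
    ∫ y, lap f y * g y = ∫ y, f y * lap g y := by
  simp only [lap, Finset.sum_mul, Finset.mul_sum]
  have h1 : (1 : WithTop ℕ∞) ≤ ((⊤ : ℕ∞) : WithTop ℕ∞) := by exact_mod_cast le_top
  rw [integral_finsetSum, integral_finsetSum]
  · refine Finset.sum_congr rfl fun i _ => ?_
    set e := EuclideanSpace.single i (1 : ℝ)
    rw [integral_fderiv_mul_eq_neg_of_hasCompactSupport ((hf.fderiv_apply_const e).of_le h1)
      (hg.of_le h1) hgc, integral_fderiv_mul_eq_neg_of_hasCompactSupport (hf.of_le h1)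
      ((hg.fderiv_apply_const e).of_le h1) (hgc.fderiv_apply ℝ e), neg_neg]
  · intro i _
    exact (hf.continuous.mul ((hg.fderiv_apply_const _).fderiv_apply_const
      _).continuous).integrable_of_hasCompactSupport
        (((hgc.fderiv_apply ℝ _).fderiv_apply ℝ _).mul_left)
  · intro i _
    exact (((hf.fderiv_apply_const _).fderiv_apply_const
      _).continuous.mul hg.continuous).integrable_of_hasCompactSupport hgc.mul_left

theorem fderiv_comp_add_smul {n : ℕ} {f : EuclideanSpace ℝ (Fin n) → ℝ}
    (hf : Differentiable ℝ f) (x : EuclideanSpace ℝ (Fin n)) (R : ℝ)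
    (y v : EuclideanSpace ℝ (Fin n)) :
    fderiv ℝ (fun z => f (x + R • z)) y v = R * fderiv ℝ f (x + R • y) v := by
  have h : HasFDerivAt (fun z : EuclideanSpace ℝ (Fin n) => x + R • z)
      (R • ContinuousLinearMap.id ℝ _) y :=
    ((hasFDerivAt_id y).const_smul R).const_add x
  rw [show fderiv ℝ (fun z => f (x + R • z)) y = _ from
    ((hf _).hasFDerivAt.comp y h).fderiv]
  simp

theorem lap_comp_add_smul {n : ℕ} {f : EuclideanSpace ℝ (Fin n) → ℝ}
    (hf : ContDiff ℝ (⊤ : ℕ∞) f) (x : EuclideanSpace ℝ (Fin n)) (R : ℝ)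
    (y : EuclideanSpace ℝ (Fin n)) :
    lap (fun z => f (x + R • z)) y = R ^ 2 * lap f (x + R • y) := by
  simp only [lap, Finset.mul_sum]
  refine Finset.sum_congr rfl fun i _ => ?_
  set e := EuclideanSpace.single i (1 : ℝ)
  have hd : Differentiable ℝ fun y => fderiv ℝ f y e :=
    (hf.fderiv_apply_const e).differentiable (by simp)
  simp only [fderiv_comp_add_smul (hf.differentiable (by simp)) x R]
  rw [fderiv_const_mul (by fun_prop), smul_apply,
    fderiv_comp_add_smul hd, smul_eq_mul]
  ring

theorem exists_bump_with_compact_support_primitive :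
    ∃ h H : ℝ → ℝ, ContDiff ℝ (⊤ : ℕ∞) h ∧ (∀ t, 0 ≤ h t) ∧ h 0 = 1 ∧ (∀ t, 2 ≤ t → h t = 0) ∧
      (∀ t, HasDerivAt H (h t) t) ∧ ∀ t, 2 ≤ t → H t = 0 := by
  let b : ContDiffBump (0 : ℝ) := ⟨1, 2, one_pos, one_lt_two⟩
  have hb : ∀ t, 2 ≤ t → b t = 0 := fun t ht =>
    b.zero_of_le_dist (by simpa [b] using ht.trans (le_abs_self t))
  refine ⟨b, fun t => ∫ s in (2 : ℝ)..t, b s, b.contDiff, b.nonneg',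
    b.one_of_mem_closedBall (by simp [b]), hb,
    fun t => intervalIntegral.integral_hasDerivAt_right (b.continuous.intervalIntegrable _ _)
      (b.continuous.stronglyMeasurableAtFilter _ _) b.continuous.continuousAt, fun t ht => ?_⟩
  beta_reduce
  rw [intervalIntegral.integral_congr (g := fun _ => 0)]
  · simp
  · intro s hs
    rw [Set.uIcc_of_le ht] at hs
    exact hb s hs.1

/-- A smooth nonnegative compactly supported kernel `φ` such that `y ↦ φ y • y` is the gradient of
a compactly supported function `Φ`. -/
theorem exists_radial_kernel (n : ℕ) :
    ∃ φ Φ : EuclideanSpace ℝ (Fin n) → ℝ, ContDiff ℝ (⊤ : ℕ∞) φ ∧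
      (∀ y, 2 ≤ ‖y‖ → φ y = 0) ∧ HasCompactSupport φ ∧ 0 < ∫ y, φ y ∧
      ContDiff ℝ 1 Φ ∧ HasCompactSupport Φ ∧
      ∀ y i, fderiv ℝ Φ y (EuclideanSpace.single i 1) = y i * φ y := by
  obtain ⟨h, H, hh, hnn, h0, hhz, hH, hHz⟩ := exists_bump_with_compact_support_primitive
  have hsq : ∀ y : EuclideanSpace ℝ (Fin n), 2 ≤ ‖y‖ → 2 ≤ ‖y‖ ^ 2 := fun y hy => by nlinarith
  have hφ : ContDiff ℝ (⊤ : ℕ∞) fun y : EuclideanSpace ℝ (Fin n) => h (‖y‖ ^ 2) :=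
    hh.comp (contDiff_norm_sq ℝ)
  have hcs : ∀ k : EuclideanSpace ℝ (Fin n) → ℝ, (∀ y, 2 ≤ ‖y‖ → k y = 0) →
      HasCompactSupport k := fun k hk =>
    HasCompactSupport.intro (isCompact_closedBall 0 2) fun y hy =>
      hk y (by simpa using (not_le.1 (fun h' => hy (by simpa using h'))).le)
  have hφz : ∀ y : EuclideanSpace ℝ (Fin n), 2 ≤ ‖y‖ → h (‖y‖ ^ 2) = 0 :=
    fun y hy => hhz _ (hsq y hy)
  have hH1 : ContDiff ℝ 1 H := by
    rw [contDiff_one_iff_deriv]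
    refine ⟨fun t => (hH t).differentiableAt, ?_⟩
    rw [show deriv H = h from funext fun t => (hH t).deriv]
    exact hh.continuous
  refine ⟨fun y => h (‖y‖ ^ 2), fun y => 2⁻¹ * H (‖y‖ ^ 2), hφ, hφz, hcs _ hφz, ?_,
    contDiff_const.mul (hH1.comp (contDiff_norm_sq ℝ)),
    hcs _ fun y hy => by simp [hHz _ (hsq y hy)], fun y i => ?_⟩
  · exact hφ.continuous.integral_pos_of_hasCompactSupport_nonneg_nonzero (hcs _ hφz)
      (fun y => hnn _) (x := 0) (by simp [h0])
  · have hd := ((hH (‖y‖ ^ 2)).comp_hasFDerivAt y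
      (hasStrictFDerivAt_norm_sq y).hasFDerivAt).const_mul (2⁻¹ : ℝ)
    rw [show fderiv ℝ (fun y : EuclideanSpace ℝ (Fin n) => 2⁻¹ * H (‖y‖ ^ 2)) y = _ from hd.fderiv]
    simp [EuclideanSpace.inner_single_right]
    ring

/-- Mean value property of harmonic functions for a smooth radial kernel. -/
theorem integral_comp_add_smul_mul_eq_of_lap_eq_zero {n : ℕ}
    {f φ Φ : EuclideanSpace ℝ (Fin n) → ℝ} (hf : ContDiff ℝ (⊤ : ℕ∞) f)
    (hlap : ∀ x, lap f x = 0) (hφ : Continuous φ) (hφc : HasCompactSupport φ)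
    (hΦ : ContDiff ℝ 1 Φ) (hΦc : HasCompactSupport Φ)
    (hgrad : ∀ y i, fderiv ℝ Φ y (EuclideanSpace.single i 1) = y i * φ y)
    (x : EuclideanSpace ℝ (Fin n)) (R : ℝ) :
    ∫ y, f (x + R • y) * φ y = f x * ∫ y, φ y := by
  have h1 : (1 : WithTop ℕ∞) ≤ ((⊤ : ℕ∞) : WithTop ℕ∞) := by exact_mod_cast le_top
  have hfd : Differentiable ℝ f := hf.differentiable (by simp)
  have hf' : Continuous (fderiv ℝ f) := hf.continuous_fderiv (by simp)
  have hcont : Continuous fun p : ℝ × EuclideanSpace ℝ (Fin n) =>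
      fderiv ℝ f (x + p.1 • p.2) p.2 * φ p.2 := by
    have : Continuous fun p : ℝ × EuclideanSpace ℝ (Fin n) => x + p.1 • p.2 := by fun_prop
    exact ((hf'.comp this).clm_apply continuous_snd).mul (hφ.comp continuous_snd)
  have hzero : ∀ r : ℝ, ∫ y, fderiv ℝ f (x + r • y) y * φ y = 0 := by
    intro r
    have hcomp : ∀ v, ContDiff ℝ (⊤ : ℕ∞) fun y => fderiv ℝ f (x + r • y) v := fun v =>
      (hf.fderiv_apply_const v).comp (contDiff_const.add (contDiff_id.const_smul _))
    have hexp : ∀ y, fderiv ℝ f (x + r • y) y * φ y =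
        ∑ i, fderiv ℝ f (x + r • y) (EuclideanSpace.single i 1) *
          fderiv ℝ Φ y (EuclideanSpace.single i 1) := by
      intro y
      have hy : y = ∑ i, y i • EuclideanSpace.single i (1 : ℝ) := by
        simpa using ((EuclideanSpace.basisFun (Fin n) ℝ).sum_repr y).symm
      conv_lhs => rw [show fderiv ℝ f (x + r • y) y = fderiv ℝ f (x + r • y)
        (∑ i, y i • EuclideanSpace.single i (1 : ℝ)) from congrArg _ hy]
      rw [map_sum, Finset.sum_mul]
      refine Finset.sum_congr rfl fun i _ => ?_
      rw [hgrad, map_smul, smul_eq_mul]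
      ring
    have hint : ∀ i, ∫ y, fderiv ℝ f (x + r • y) (EuclideanSpace.single i 1) *
          fderiv ℝ Φ y (EuclideanSpace.single i 1) =
        -∫ y, r * fderiv ℝ (fun z => fderiv ℝ f z (EuclideanSpace.single i 1)) (x + r • y)
          (EuclideanSpace.single i 1) * Φ y := by
      intro i
      set e := EuclideanSpace.single i (1 : ℝ)
      rw [← neg_eq_iff_eq_neg, ← integral_fderiv_mul_eq_neg_of_hasCompactSupport
        ((hcomp e).of_le h1) hΦ hΦc]
      simp only [fderiv_comp_add_smul ((hf.fderiv_apply_const e).differentiable (by simp)) x r]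
    simp only [hexp]
    rw [integral_finsetSum]
    · simp only [hint]
      rw [Finset.sum_neg_distrib, ← integral_finsetSum]
      · simp only [← Finset.sum_mul, ← Finset.mul_sum]
        have : ∀ y, ∑ i, fderiv ℝ (fun z => fderiv ℝ f z (EuclideanSpace.single i 1)) (x + r • y)
            (EuclideanSpace.single i 1) = 0 := fun y => hlap (x + r • y)
        simp [this]
      · intro i _
        refine Continuous.integrable_of_hasCompactSupport ?_ hΦc.mul_left
        exact (continuous_const.mul (((hf.fderiv_apply_const _).fderiv_apply_const
          _).continuous.comp (by fun_prop))).mul hΦ.continuous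
    · intro i _
      exact ((hcomp _).continuous.mul ((hΦ.continuous_fderiv one_ne_zero).clm_apply
        continuous_const)).integrable_of_hasCompactSupport (hΦc.fderiv_apply ℝ _).mul_left
  have hFcont : ∀ r : ℝ, Continuous fun y => f (x + r • y) * φ y := fun r =>
    (hf.continuous.comp (by fun_prop)).mul hφ
  have hderiv : ∀ r : ℝ, HasDerivAt (fun r => ∫ y, f (x + r • y) * φ y) 0 r := by
    intro r
    obtain ⟨C, hC⟩ := ((isCompact_closedBall r 1).prod hφc).exists_bound_of_continuousOn
      hcont.continuousOn
    have key := (hasDerivAt_integral_of_dominated_loc_of_deriv_le (μ := volume)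
      (F := fun r y => f (x + r • y) * φ y)
      (F' := fun r y => fderiv ℝ f (x + r • y) y * φ y)
      (bound := (tsupport φ).indicator fun _ => C)
      (Metric.closedBall_mem_nhds r one_pos)
      (Filter.Eventually.of_forall fun r => (hFcont r).aestronglyMeasurable)
      ((hFcont r).integrable_of_hasCompactSupport hφc.mul_left)
      (hcont.comp (by fun_prop : Continuous fun y => (r, y))).aestronglyMeasurable
      (ae_of_all _ fun y t ht => ?_)
      ((integrable_indicator_iff (isClosed_tsupport φ).measurableSet).2
        (integrableOn_const hφc.measure_lt_top.ne))
      (ae_of_all _ fun y t _ => ?_)).2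
    · simpa only [hzero] using key
    · by_cases hy : y ∈ tsupport φ
      · simpa [hy] using hC (t, y) ⟨ht, hy⟩
      · simp [hy, image_eq_zero_of_notMem_tsupport hy]
    · have hl : HasDerivAt (fun t : ℝ => x + t • y) y t := by
        simpa using ((hasDerivAt_id t).smul_const y).const_add x
      exact ((hfd _).hasFDerivAt.comp_hasDerivAt t hl).mul_const _
  have hconst := is_const_of_deriv_eq_zero (fun r => (hderiv r).differentiableAt)
    (fun r => (hderiv r).deriv) R 0
  simpa [integral_const_mul] using hconst

theorem lap_eq_zero_of_norm_ge {n : ℕ} {φ : EuclideanSpace ℝ (Fin n) → ℝ} {r : ℝ}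
    (hφ : ∀ y, r ≤ ‖y‖ → φ y = 0) (y : EuclideanSpace ℝ (Fin n)) (hy : r < ‖y‖) :
    lap φ y = 0 := by
  have hopen : IsOpen {z : EuclideanSpace ℝ (Fin n) | r < ‖z‖} :=
    isOpen_lt continuous_const continuous_norm
  have h : φ =ᶠ[nhds y] fun _ => 0 := by
    filter_upwards [hopen.mem_nhds hy] with z hz using hφ z (le_of_lt hz)
  refine Finset.sum_eq_zero fun i _ => ?_
  have h' : (fun z => fderiv ℝ φ z (EuclideanSpace.single i 1)) =ᶠ[nhds y] fun _ => 0 := by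
    filter_upwards [h.fderiv (𝕜 := ℝ)] with z hz
    simp [hz]
  rw [h'.fderiv_eq]
  simp

theorem nonpos_of_forall_mul_sq_le {c K a : ℝ} (hK : 0 ≤ K) (ha : 0 ≤ a)
    (h : ∀ R : ℝ, 0 < R → c * R ^ 2 ≤ K * (a + 2 * R)) : c ≤ 0 := by
  by_contra! hc
  have hq : 0 ≤ K * (a + 2) / c := by positivity
  set q := K * (a + 2) / c with hqdef
  have hcq : c * q = K * (a + 2) := by rw [hqdef]; field_simp
  have h1 := h (1 + q) (by linarith)
  have h2 : K * (a + 2 * (1 + q)) ≤ K * (a + 2) * (1 + q) := by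
    have : 0 ≤ K * (a * q) := by positivity
    nlinarith
  have h3 : c * (1 + q) ^ 2 = c * (1 + q) + K * (a + 2) * (1 + q) := by
    rw [← hcq]; ring
  have : 0 < c * (1 + q) := by positivity
  linarith

/-- A biharmonic function on ℝⁿ with sublinear growth is harmonic. -/
theorem biharmonic_sublinear_harmonic {n : ℕ} (u : EuclideanSpace ℝ (Fin n) → ℝ)
    (hu : ContDiff ℝ (⊤ : ℕ∞) u) (hbih : ∀ x, lap (lap u) x = 0)
    (B s : ℝ) (hB : 0 < B) (hs0 : 0 ≤ s) (hs1 : s < 1)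
    (hgrow : ∀ x, |u x| ≤ B * (1 + ‖x‖ ^ s)) :
    ∀ x, lap u x = 0 := by
  intro x
  obtain ⟨φ, Φ, hφ, hφz, hφc, hpos, hΦ, hΦc, hgrad⟩ := exists_radial_kernel n
  have hlapz := lap_eq_zero_of_norm_ge hφz
  have hlapc : HasCompactSupport (lap φ) :=
    HasCompactSupport.intro (isCompact_closedBall 0 2) fun y hy =>
      hlapz y (not_le.1 fun h' => hy (by simpa using h'))
  have hlapint : Integrable fun y => |lap φ y| :=
    (hφ.lap.continuous.integrable_of_hasCompactSupport hlapc).abs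
  set M := ∫ y, |lap φ y|
  have hM : 0 ≤ M := integral_nonneg fun y => abs_nonneg _
  have hgrow' : ∀ z, |u z| ≤ B * (2 + ‖z‖) := by
    intro z
    refine (hgrow z).trans (mul_le_mul_of_nonneg_left ?_ hB.le)
    have : ‖z‖ ^ s ≤ 1 + ‖z‖ := by
      calc ‖z‖ ^ s ≤ (1 + ‖z‖) ^ s :=
            Real.rpow_le_rpow (norm_nonneg z) (by linarith) hs0
        _ ≤ (1 + ‖z‖) ^ (1 : ℝ) :=
            Real.rpow_le_rpow_of_exponent_le (by linarith [norm_nonneg z]) hs1.le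
        _ = 1 + ‖z‖ := Real.rpow_one _
    linarith
  have hbound : ∀ R : ℝ, 0 < R →
      (|lap u x| * ∫ y, φ y) * R ^ 2 ≤ (B * M) * ((2 + ‖x‖) + 2 * R) := by
    intro R hR
    have hw : ContDiff ℝ (⊤ : ℕ∞) fun y => u (x + R • y) :=
      hu.comp (contDiff_const.add (contDiff_id.const_smul _))
    have hmean := integral_comp_add_smul_mul_eq_of_lap_eq_zero hu.lap hbih hφ.continuous hφc
      hΦ hΦc hgrad x R
    have hgreen := integral_lap_mul_eq_of_hasCompactSupport hw hφ hφc
    simp only [lap_comp_add_smul hu, mul_assoc, integral_const_mul] at hgreen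
    rw [hmean] at hgreen
    calc (|lap u x| * ∫ y, φ y) * R ^ 2 = |∫ y, u (x + R • y) * lap φ y| := by
          rw [← hgreen, abs_mul, abs_mul, abs_of_pos hpos, abs_of_nonneg (sq_nonneg R)]
          ring
      _ ≤ ∫ y, B * ((2 + ‖x‖) + 2 * R) * |lap φ y| := by
          rw [← Real.norm_eq_abs (∫ y, u (x + R • y) * lap φ y)]
          refine norm_integral_le_of_norm_le (hlapint.const_mul _) (ae_of_all _ fun y => ?_)
          rw [Real.norm_eq_abs, abs_mul]
          rcases le_or_gt ‖y‖ 2 with hy | hy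
          · refine mul_le_mul_of_nonneg_right ((hgrow' _).trans ?_) (abs_nonneg _)
            refine mul_le_mul_of_nonneg_left ?_ hB.le
            have h1 := norm_add_le x (R • y)
            rw [norm_smul, Real.norm_of_nonneg hR.le] at h1
            nlinarith
          · simp [hlapz y hy]
      _ = (B * M) * ((2 + ‖x‖) + 2 * R) := by
          rw [integral_const_mul]
          ring
  have hle := nonpos_of_forall_mul_sq_le (by positivity) (by positivity) hbound
  have : |lap u x| ≤ 0 := by
    by_contra! h
    exact absurd hle (not_le.2 (mul_pos h hpos))
  exact abs_nonpos_iff.1 this
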